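/- arXiv:2412.12904 — 3 statements merged into one kernel-verified Lean document; each statement's English description precedes it below -/
import Mathlib

section
/- If G is a Sidorenko graph, then the subdivision of G (replacing each edge by a path of length 2) is Sidorenko: for every graph H, t(G', H) ≥ t(K₂, H)^{2e(G)}, where G' is the subdivision of G. -/
open Finset
open scoped Classical

/-- The homomorphism density `t(G, H)`: the probability that a uniformly random map
`V(G) → V(H)` is a graph homomorphism. -/
noncomputable def homDensity {V W : Type} [Fintype V] [Fintype W]
    (G : SimpleGraph V) (H : SimpleGraph W) : ℝ :=
  ((Finset.univ.filter
      (fun f : V → W => ∀ ⦃u v : V⦄, G.Adj u v → H.Adj (f u) (f v))).card : ℝ) /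
    (Fintype.card W : ℝ) ^ (Fintype.card V)

/-- The 1-subdivision of a graph `G`: each edge is replaced by a path of length two
through a new vertex. -/
def subdivision {V : Type} (G : SimpleGraph V) : SimpleGraph (V ⊕ G.edgeSet) :=
  SimpleGraph.fromRel (fun x y =>
    match x, y with
    | .inl v, .inr e => v ∈ (e : Sym2 V)
    | _, _ => False)

section Sub

/-- Condition for a pair of maps to be a homomorphism of the subdivision. -/
def SubHom {V W : Type} (F : SimpleGraph V) (H : SimpleGraph W) (g : V → W)
    (h : F.edgeSet → W) : Prop :=
  ∀ e : F.edgeSet, ∀ v ∈ (e : Sym2 V), H.Adj (g v) (h e)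

/-- Fraction of admissible maps on edges. -/
noncomputable def qfrac {V W : Type} [Fintype V] [Fintype W] (F : SimpleGraph V)
    (H : SimpleGraph W) (g : V → W) : ℝ :=
  ((univ.filter (fun h : F.edgeSet → W => SubHom F H g h)).card : ℝ) /
    (Fintype.card W : ℝ) ^ (Fintype.card F.edgeSet)

lemma subdivision_hom_iff {V W : Type} (F : SimpleGraph V) (H : SimpleGraph W)
    (f : V ⊕ F.edgeSet → W) :
    (∀ ⦃u v⦄, (subdivision F).Adj u v → H.Adj (f u) (f v)) ↔
      SubHom F H (fun v => f (.inl v)) (fun e => f (.inr e)) := by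
  constructor
  · intro hf e v hv
    apply hf
    simp [subdivision, hv]
  · intro hf u v huv
    rcases u with u | u <;> rcases v with v | v <;> simp [subdivision] at huv
    · exact hf v u huv
    · exact (hf u v huv).symm

lemma sum_eqv {α β M : Type} {i : Fintype α} [Fintype β] [AddCommMonoid M] (e : β ≃ α)
    (f : α → M) : ∑ x, f x = ∑ y, f (e y) := (Equiv.sum_comp e f).symm

lemma subdivision_density {V W : Type} [Fintype V] [Fintype W] (F : SimpleGraph V)
    {iS : Fintype (V ⊕ F.edgeSet)} (H : SimpleGraph W) :
    homDensity (subdivision F) H =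
      (∑ g : V → W, qfrac F H g) / (Fintype.card W : ℝ) ^ (Fintype.card V) := by
  have hiS : iS = @instFintypeSum V F.edgeSet _ _ := Subsingleton.elim _ _
  subst hiS
  unfold homDensity qfrac
  rw [← Finset.sum_div, div_div, Fintype.card_sum, pow_add, mul_comm (_ ^ _)]
  congr 1
  rw [← Nat.cast_sum, Nat.cast_inj]
  simp_rw [subdivision_hom_iff, Finset.card_filter]
  rw [sum_eqv (Equiv.sumArrowEquivProdArrow V F.edgeSet W).symm, Fintype.sum_prod_type]
  rfl

/-- Restricting uniform functions along an injection. -/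
lemma card_restrict {E S W : Type} [Fintype E] [Fintype S] [Fintype W] (ι : E → S)
    (hι : Function.Injective ι) (Q : (E → W) → Prop) [Nonempty W]
    {iS : Fintype (S → W)} {iE : Fintype (E → W)} :
    ((univ.filter (fun z : S → W => Q (z ∘ ι))).card : ℝ) / (Fintype.card W : ℝ) ^ Fintype.card S =
    ((univ.filter Q).card : ℝ) / (Fintype.card W : ℝ) ^ Fintype.card E := by
  let C := {s : S // s ∉ Set.range ι}
  let φ : E ⊕ C ≃ S :=
    (Equiv.sumCongr (Equiv.ofInjective ι hι) (Equiv.refl _)).trans (Equiv.Set.sumCompl (Set.range ι))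
  have hφ : ∀ e, φ (.inl e) = ι e := by intro e; rfl
  have hS : Fintype.card S = Fintype.card E + Fintype.card C := by
    rw [← Fintype.card_sum]; exact (Fintype.card_congr φ).symm
  have hn : (Fintype.card W : ℝ) ≠ 0 := by simp
  have key : (univ.filter (fun z : S → W => Q (z ∘ ι))).card
      = (univ.filter Q).card * Fintype.card W ^ Fintype.card C := by
    let ψ : (S → W) ≃ (E → W) × (C → W) :=
      (Equiv.arrowCongr φ.symm (Equiv.refl W)).trans (Equiv.sumArrowEquivProdArrow E C W)
    have hψ : ∀ z, (ψ z).1 = z ∘ ι := by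
      intro z; ext e; simp [ψ, ← hφ]
    simp_rw [← hψ, Finset.card_filter]
    rw [ψ.sum_comp (fun p => if Q p.1 then 1 else 0), Fintype.sum_prod_type, Finset.sum_mul]
    refine Finset.sum_congr rfl fun x _ => ?_
    by_cases hx : Q x <;> simp [hx]
  rw [key, hS, pow_add]
  push_cast
  field_simp

/-- The random graph attached to a labelling. -/
def rgraph {A W : Type} (p : A → W) (H : SimpleGraph W) (z : Sym2 A → W) : SimpleGraph A where
  Adj a b := a ≠ b ∧ ∀ c ∈ s(a, b), H.Adj (p c) (z s(a, b))
  symm := ⟨fun a b h => ⟨h.1.symm, by rw [Sym2.eq_swap]; exact h.2⟩⟩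
  loopless := ⟨fun a h => h.1 rfl⟩

lemma rgraph_hom_iff {V A W : Type} (F : SimpleGraph V) (p : A → W) (H : SimpleGraph W)
    (z : Sym2 A → W) (f : V → A) (hf : Function.Injective f) :
    (∀ ⦃u v⦄, F.Adj u v → (rgraph p H z).Adj (f u) (f v)) ↔
      SubHom F H (p ∘ f) (z ∘ fun e : F.edgeSet => Sym2.map f e) := by
  constructor
  · rintro h ⟨e, he⟩ v hv
    induction e using Sym2.ind with
    | _ x y =>
      have := (h he).2 (f v) (by
        simp at hv ⊢
        rcases hv with rfl | rfl <;> simp)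
      simpa using this
  · intro h u v huv
    refine ⟨fun e => huv.ne (hf e), ?_⟩
    intro c hc
    simp at hc
    rcases hc with rfl | rfl
    · simpa using h ⟨s(u,v), huv⟩ u (by simp)
    · simpa using h ⟨s(u,v), huv⟩ v (by simp)

lemma card_noninj {V A : Type} [Fintype V] [Fintype A] [Nonempty A] :
    ((univ.filter (fun f : V → A => ¬ Function.Injective f)).card : ℝ) /
      (Fintype.card A : ℝ) ^ Fintype.card V ≤ (Fintype.card V : ℝ) ^ 2 / Fintype.card A := by
  have hA : (0:ℝ) < Fintype.card A := by simp [Fintype.card_pos]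
  have h1 : ∀ u w : V, (univ.filter (fun f : V → A => u ≠ w ∧ f u = f w)).card * Fintype.card A
      ≤ Fintype.card A ^ Fintype.card V := by
    intro u w
    by_cases huw : u = w
    · simp [huw]
    have hc : (univ.filter (fun f : V → A => u ≠ w ∧ f u = f w)).card ≤
        Fintype.card ({x // x ≠ u} → A) := by
      refine Finset.card_le_card_of_injOn (fun f x => f x) (by simp) ?_
      intro f hf g hg hfg
      simp at hf hg
      ext x
      by_cases hx : x = u
      · subst hx
        rw [hf.2, hg.2]
        exact congrFun hfg ⟨w, fun h => huw h.symm⟩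
      · exact congrFun hfg ⟨x, hx⟩
    have hV : Fintype.card V = Fintype.card {x // x ≠ u} + 1 := by
      have : 0 < Fintype.card V := Fintype.card_pos_iff.2 ⟨u⟩
      simp; omega
    rw [hV, pow_succ]
    rw [Fintype.card_fun] at hc
    exact Nat.mul_le_mul_right _ hc
  have h2 : (univ.filter (fun f : V → A => ¬ Function.Injective f)).card * Fintype.card A
      ≤ Fintype.card V ^ 2 * Fintype.card A ^ Fintype.card V := by
    have : (univ.filter (fun f : V → A => ¬ Function.Injective f)) ⊆
      (univ : Finset (V × V)).biUnion
        (fun q => univ.filter (fun f : V → A => q.1 ≠ q.2 ∧ f q.1 = f q.2)) := by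
      intro f hf
      simp [Function.Injective] at hf ⊢
      obtain ⟨a, b, h, h'⟩ := hf
      exact ⟨a, b, h', h⟩
    have h3 := (Finset.card_le_card this).trans Finset.card_biUnion_le
    refine (Nat.mul_le_mul_right _ h3).trans ?_
    rw [Finset.sum_mul]
    refine (Finset.sum_le_sum (fun q _ => h1 q.1 q.2)).trans ?_
    simp [sq]
  rw [div_le_div_iff₀ (by positivity) hA]
  exact_mod_cast h2

lemma frac_le_one {X : Type} [Fintype X] (Q : X → Prop) {c : ℝ} (hc : c = Fintype.card X) :
    0 ≤ ((univ.filter Q).card : ℝ) / c ∧ ((univ.filter Q).card : ℝ) / c ≤ 1 := by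
  subst hc
  refine ⟨by positivity, div_le_one_of_le₀ ?_ (by positivity)⟩
  exact_mod_cast Finset.card_le_univ _

/-- average density of random graphs -/
noncomputable def avgD {V W : Type} [Fintype V] [Fintype W] (F : SimpleGraph V)
    (H : SimpleGraph W) (N : ℕ) : ℝ :=
  (∑ z : Sym2 (W × Fin (N+1)) → W, homDensity F (rgraph Prod.fst H z)) /
    Fintype.card (Sym2 (W × Fin (N+1)) → W)

lemma card_fun_gen {S W : Type} [Fintype S] [Fintype W] {i : Fintype (S → W)} :
    (Fintype.card W : ℝ) ^ Fintype.card S = (@Fintype.card (S → W) i : ℝ) := by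
  have : @Fintype.card (S → W) i = Fintype.card W ^ Fintype.card S := by
    rw [← @Nat.card_eq_fintype_card _ i, Nat.card_fun, Nat.card_eq_fintype_card,
      Nat.card_eq_fintype_card]
  rw [this, Nat.cast_pow]

/-- Fraction of labellings for which `f` is a homomorphism. -/
noncomputable def rfrac {V W A Y : Type} [Fintype W] [Fintype Y] (iZ : Fintype (Y → W))
    (F : SimpleGraph V) (R : (Y → W) → SimpleGraph A) (f : V → A) : ℝ :=
  ((univ.filter (fun z : Y → W => ∀ ⦃u v⦄, F.Adj u v →
      (R z).Adj (f u) (f v))).card : ℝ) / (Fintype.card W : ℝ) ^ Fintype.card Y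

lemma rfrac_avg {V W A Y : Type} [Fintype V] [Fintype A] [Fintype W] [Fintype Y]
    (iZ : Fintype (Y → W)) (F : SimpleGraph V) (R : (Y → W) → SimpleGraph A) :
    (∑ z : Y → W, homDensity F (R z)) / (Fintype.card (Y → W) : ℝ)
      = (∑ f, rfrac iZ F R f) / (Fintype.card A : ℝ) ^ Fintype.card V := by
  unfold homDensity rfrac
  rw [← Finset.sum_div, ← Finset.sum_div, div_div, div_div, mul_comm]
  congr 1
  · simp_rw [Finset.card_filter]
    push_cast
    rw [Finset.sum_comm]
  · rw [card_fun_gen (S := Y)]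

lemma rfrac_inj {V W A : Type} [Fintype V] [Fintype W] [Nonempty W] 
    (iY : Fintype (Sym2 A)) (iZ : Fintype (Sym2 A → W))
    (p : A → W) (F : SimpleGraph V) (H : SimpleGraph W) (f : V → A) (hf : Function.Injective f) :
    rfrac iZ F (rgraph p H) f = qfrac F H (p ∘ f) := by
  unfold rfrac qfrac
  simp_rw [rgraph_hom_iff F _ H _ f hf]
  exact card_restrict (fun e : F.edgeSet => Sym2.map f e)
    ((Sym2.map.injective hf).comp Subtype.val_injective) (SubHom F H (p ∘ f))

lemma sum_close {V A : Type} [Fintype V] [Fintype A] [Nonempty A] (r q : (V → A) → ℝ)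
    (hr : ∀ f, 0 ≤ r f ∧ r f ≤ 1) (hq : ∀ f, 0 ≤ q f ∧ q f ≤ 1)
    (hinj : ∀ f, Function.Injective f → r f = q f) :
    |(∑ f, r f) / (Fintype.card A : ℝ) ^ Fintype.card V -
      (∑ f, q f) / (Fintype.card A : ℝ) ^ Fintype.card V|
      ≤ (Fintype.card V : ℝ) ^ 2 / Fintype.card A := by
  have hA : (0:ℝ) < Fintype.card A := by simp [Fintype.card_pos]
  rw [← sub_div, ← Finset.sum_sub_distrib, abs_div, abs_of_pos (pow_pos hA _)]
  have h3 : |∑ f, (r f - q f)| ≤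
      ((univ.filter (fun f : V → A => ¬ Function.Injective f)).card : ℝ) := by
    refine (Finset.abs_sum_le_sum_abs _ _).trans ?_
    rw [Finset.card_filter]
    push_cast
    refine Finset.sum_le_sum fun f _ => ?_
    by_cases hf : Function.Injective f
    · simp [hf, hinj f hf]
    · simp only [hf, not_false_eq_true, if_true]
      have h1 := hq f
      have h2 := hr f
      rw [abs_le]
      constructor <;> linarith [h1.1, h1.2, h2.1, h2.2]
  exact (div_le_div_of_nonneg_right h3 (by positivity)).trans card_noninj

lemma avg_close_gen {V W A : Type} [Fintype V] [Fintype W] [Nonempty W] [Fintype A] [Nonempty A]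
    (iY : Fintype (Sym2 A)) (iZ : Fintype (Sym2 A → W))
    (p : A → W) (F : SimpleGraph V) (H : SimpleGraph W) :
    |(∑ z : Sym2 A → W, homDensity F (rgraph p H z)) / (@Fintype.card (Sym2 A → W) iZ : ℝ) -
      (∑ f : V → A, qfrac F H (p ∘ f)) / (Fintype.card A : ℝ) ^ Fintype.card V|
      ≤ (Fintype.card V : ℝ) ^ 2 / Fintype.card A := by
  rw [rfrac_avg iZ F (rgraph p H)]
  refine sum_close _ _ ?_ ?_ ?_
  · exact fun f => frac_le_one _ card_fun_gen
  · exact fun f => frac_le_one _ card_fun_gen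
  · exact fun f hf => rfrac_inj iY iZ p F H f hf

lemma density_blowup {V W B : Type} [Fintype V] [Fintype W] [Nonempty W] [Fintype B] [Nonempty B]
    (F : SimpleGraph V) {iS : Fintype (V ⊕ F.edgeSet)} (H : SimpleGraph W) :
    homDensity (subdivision F) H =
      (∑ f : V → W × B, qfrac F H (Prod.fst ∘ f)) /
        (Fintype.card (W × B) : ℝ) ^ Fintype.card V := by
  have hn : (0:ℝ) < Fintype.card W := by simp [Fintype.card_pos]
  have hB : (0:ℝ) < Fintype.card B := by simp [Fintype.card_pos]
  rw [subdivision_density, sum_eqv (Equiv.arrowProdEquivProdArrow V (fun _ => W) (fun _ => B)).symm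
    (fun f : V → W × B => qfrac F H (Prod.fst ∘ f)), Fintype.sum_prod_type]
  have : ∀ (x : V → W) (y : V → B), qfrac F H (Prod.fst ∘
    ((Equiv.arrowProdEquivProdArrow V (fun _ => W) (fun _ => B)).symm (x, y))) = qfrac F H x :=
    fun x y => rfl
  simp_rw [this]
  simp only [Finset.sum_const, Finset.card_univ, Fintype.card_fun, nsmul_eq_mul]
  rw [← Finset.mul_sum, Fintype.card_prod]
  push_cast
  rw [mul_pow]
  field_simp

lemma avg_close {V W : Type} [Fintype V] [Fintype W] [Nonempty W] (F : SimpleGraph V)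
    {iS : Fintype (V ⊕ F.edgeSet)} (H : SimpleGraph W) (N : ℕ) :
    |avgD F H N - homDensity (subdivision F) H| ≤ (Fintype.card V : ℝ) ^ 2 / ((N:ℝ) + 1) := by
  rw [density_blowup (B := Fin (N+1)) F H, avgD]
  refine (avg_close_gen inferInstance _ Prod.fst F H).trans ?_
  refine div_le_div_of_nonneg_left (by positivity) (by positivity) ?_
  rw [Fintype.card_prod, Fintype.card_fin]
  push_cast
  have : (1:ℝ) ≤ Fintype.card W := by exact_mod_cast Fintype.card_pos
  nlinarith [(Nat.cast_nonneg N : (0:ℝ) ≤ N)]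

lemma avg_tendsto {V W : Type} [Fintype V] [Fintype W] [Nonempty W] (F : SimpleGraph V)
    {iS : Fintype (V ⊕ F.edgeSet)} (H : SimpleGraph W) :
    Filter.Tendsto (avgD F H) Filter.atTop (nhds (homDensity (subdivision F) H)) := by
  rw [tendsto_iff_norm_sub_tendsto_zero]
  refine squeeze_zero (fun _ => norm_nonneg _) (fun N => avg_close F H N) ?_
  have := (tendsto_one_div_add_atTop_nhds_zero_nat (𝕜 := ℝ)).const_mul ((Fintype.card V : ℝ) ^ 2)
  simpa [div_eq_mul_inv] using this

lemma homDensity_nonneg {V W : Type} [Fintype V] [Fintype W] (F : SimpleGraph V)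
    (H : SimpleGraph W) : 0 ≤ homDensity F H := by
  unfold homDensity; positivity

lemma avg_pow {X : Type} [Fintype X] [Nonempty X] (f : X → ℝ) (hf : ∀ x, 0 ≤ f x) (k : ℕ) :
    ((∑ x, f x) / Fintype.card X) ^ k ≤ (∑ x, f x ^ k) / Fintype.card X := by
  have hX : (Fintype.card X : ℝ) ≠ 0 := by simp
  rcases k with _ | k
  · simp [hX]
  have h := pow_sum_div_card_le_sum_pow (s := univ) (f := f) (fun x _ => hf x) k
  rw [Finset.card_univ] at h
  rw [div_pow, pow_succ (Fintype.card X : ℝ), ← div_div]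
  exact div_le_div_of_nonneg_right h (by positivity)

lemma k2_path {W : Type} [Fintype W] [Nonempty W]
    {iS : Fintype (Fin 2 ⊕ (⊤ : SimpleGraph (Fin 2)).edgeSet)} (H : SimpleGraph W) :
    homDensity (⊤ : SimpleGraph (Fin 2)) H ^ 2 ≤
      homDensity (subdivision (⊤ : SimpleGraph (Fin 2))) H := by
  have hn : (0:ℝ) < Fintype.card W := by simp [Fintype.card_pos]
  let d : W → ℝ := fun w => ∑ x, if H.Adj x w then 1 else 0
  have e1 : homDensity (⊤ : SimpleGraph (Fin 2)) H = (∑ w, d w) / (Fintype.card W : ℝ) ^ 2 := by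
    unfold homDensity
    rw [Fintype.card_fin]
    congr 1
    rw [Finset.card_filter, sum_eqv (finTwoArrowEquiv W).symm, Fintype.sum_prod_type,
      Finset.sum_comm]
    push_cast
    refine Finset.sum_congr rfl fun w _ => Finset.sum_congr rfl fun x _ => ?_
    congr 1
    simp [finTwoArrowEquiv, Fin.forall_fin_two, H.adj_comm w x]
  have hE : ∀ e ∈ (⊤ : SimpleGraph (Fin 2)).edgeSet, e = s(0, 1) := by
    intro e he
    induction e using Sym2.ind with
    | _ x y =>
      fin_cases x <;> fin_cases y <;> simp at he ⊢
  let e0 : (⊤ : SimpleGraph (Fin 2)).edgeSet := ⟨s(0,1), by simp⟩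
  let U : Unique (⊤ : SimpleGraph (Fin 2)).edgeSet := ⟨⟨e0⟩, fun e => Subtype.ext (hE e.1 e.2)⟩
  have e2 : homDensity (subdivision (⊤ : SimpleGraph (Fin 2))) H =
      (∑ w, d w ^ 2) / (Fintype.card W : ℝ) ^ 3 := by
    rw [subdivision_density]
    unfold qfrac
    rw [← Finset.sum_div, div_div, ← pow_add, Fintype.card_fin]
    have : ∀ i : Fintype (⊤ : SimpleGraph (Fin 2)).edgeSet,
        @Fintype.card (⊤ : SimpleGraph (Fin 2)).edgeSet i = 1 := by
      intro i
      rw [Fintype.card_eq_one_iff]; exact ⟨e0, U.uniq⟩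
    rw [this]
    congr 1
    simp_rw [Finset.card_filter]
    push_cast
    rw [Finset.sum_comm, sum_eqv (Equiv.funUnique (⊤ : SimpleGraph (Fin 2)).edgeSet W).symm]
    refine Finset.sum_congr rfl fun w _ => ?_
    rw [sum_eqv (finTwoArrowEquiv W).symm, Fintype.sum_prod_type, sq, Finset.sum_mul_sum]
    refine Finset.sum_congr rfl fun x _ => Finset.sum_congr rfl fun y _ => ?_
    have : SubHom (⊤ : SimpleGraph (Fin 2)) H ((finTwoArrowEquiv W).symm (x, y))
        ((Equiv.funUnique (⊤ : SimpleGraph (Fin 2)).edgeSet W).symm w) ↔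
        H.Adj x w ∧ H.Adj y w := by
      constructor
      · intro h
        exact ⟨h e0 0 (by simp [e0]), h e0 1 (by simp [e0])⟩
      · rintro ⟨h1, h2⟩ e v _
        fin_cases v
        · exact h1
        · exact h2
    simp only [this]
    by_cases h1 : H.Adj x w <;> by_cases h2 : H.Adj y w <;> simp [h1, h2]
  rw [e1, e2]
  have h := sq_sum_le_card_mul_sum_sq (s := univ) (f := d)
  rw [Finset.card_univ] at h
  rw [div_pow, div_le_div_iff₀ (by positivity) (by positivity)]
  calc _ ≤ (Fintype.card W * ∑ w, d w ^ 2) * (Fintype.card W : ℝ) ^ 3 := by gcongr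
    _ = _ := by ring

end Sub

/-- If `G` is Sidorenko, then its 1-subdivision is Sidorenko. -/
theorem subdivision_sidorenko {V : Type} [Fintype V] (G : SimpleGraph V)
    (hG : ∀ (W : Type) [Fintype W] (H : SimpleGraph W),
      homDensity G H ≥ homDensity (⊤ : SimpleGraph (Fin 2)) H ^ G.edgeFinset.card) :
    ∀ (W : Type) [Fintype W] (H : SimpleGraph W),
      homDensity (subdivision G) H
        ≥ homDensity (⊤ : SimpleGraph (Fin 2)) H ^ (2 * G.edgeFinset.card) := by
  intro W _ H
  rcases isEmpty_or_nonempty W with hW | hW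
  · have h0 : homDensity (⊤ : SimpleGraph (Fin 2)) H = 0 := by
      unfold homDensity; simp
    by_cases he : G.edgeFinset.card = 0
    · have h1 := hG W H
      rw [he] at h1 ⊢
      have hV : IsEmpty V := by
        by_contra hV
        rw [not_isEmpty_iff] at hV
        have : homDensity G H = 0 := by
          unfold homDensity; simp
        rw [this] at h1
        norm_num at h1
      have : IsEmpty G.edgeSet := ⟨fun e => by
        obtain ⟨e, -⟩ := e
        induction e using Sym2.ind with
        | _ x y => exact hV.false x⟩
      rw [subdivision_density]
      unfold qfrac
      have hs : ∀ g (h : G.edgeSet → W), SubHom G H g h := fun g h e => (this.false e).elim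
      simp [hs]
    · rw [h0, zero_pow (by omega)]
      exact homDensity_nonneg _ _
  · rw [pow_mul]
    have h1 : homDensity (subdivision (⊤ : SimpleGraph (Fin 2))) H ^ G.edgeFinset.card ≤
        homDensity (subdivision G) H := by
      refine le_of_tendsto_of_tendsto' ((avg_tendsto _ H).pow _) (avg_tendsto G H) fun N => ?_
      refine (avg_pow _ (fun z => homDensity_nonneg _ _) _).trans ?_
      unfold avgD
      refine div_le_div_of_nonneg_right (Finset.sum_le_sum fun z _ => hG _ _) (by positivity)
    exact (pow_le_pow_left₀ (by positivity) (k2_path H) _).trans h1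
end

section
/- Loose expansions of Sidorenko graphs are Sidorenko, simplest instance: if G is a Sidorenko 2-uniform graph, then the 3-uniform loose expansion G⁺ (obtained by adding one new vertex to each edge) satisfies t(G⁺, H) ≥ t(K₃^{(3)}, H)^{e(G)} for every 3-uniform hypergraph H, where K₃^{(3)} is a single 3-uniform edge. -/
open Finset
open scoped Classical

/-- A hypergraph on vertex type `V` is given by its finite set of hyperedges. The
homomorphism density `t(G, H)` is the probability that a uniformly random map
`V(G) → V(H)` sends every hyperedge of `G` to a hyperedge of `H`. -/
noncomputable def hHomDensity {V W : Type} [Fintype V] [Fintype W]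
    (G : Finset (Finset V)) (H : Finset (Finset W)) : ℝ :=
  ((Finset.univ.filter
      (fun f : V → W => ∀ e ∈ G, e.image f ∈ H)).card : ℝ) /
    (Fintype.card W : ℝ) ^ (Fintype.card V)

/-- The 3-uniform loose expansion of a 2-uniform graph `G`: one new vertex is added to each
edge, giving hyperedges `{u, v, e}` for each edge `e = {u,v}` of `G`. -/
noncomputable def looseExpansion {V : Type} [Fintype V] (G : SimpleGraph V) :
    Finset (Finset (V ⊕ G.edgeSet)) :=
  Finset.univ.image (fun e : G.edgeSet =>
    insert (Sum.inr e) ((Finset.univ.filter (· ∈ (e : Sym2 V))).image Sum.inl))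

/-- A single 3-uniform edge `K₃⁽³⁾`. -/
def K3edge : Finset (Finset (Fin 3)) := {Finset.univ}

/-- Codegree of an unordered pair. -/
noncomputable def codeg {W : Type} [Fintype W] (H : Finset (Finset W)) (p : Sym2 W) : ℕ :=
  (Finset.univ.filter (fun z : W => insert z (Finset.univ.filter (· ∈ p)) ∈ H)).card

lemma codeg_diag {W : Type} [Fintype W] (H : Finset (Finset W)) (hH : ∀ e ∈ H, e.card = 3)
    (x : W) : codeg H s(x, x) = 0 := by
  unfold codeg
  rw [Finset.card_eq_zero, Finset.filter_eq_empty_iff]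
  intro z _ hz
  have h := hH _ hz
  have h1 : (Finset.univ.filter (· ∈ s(x, x))) = ({x} : Finset W) := by
    ext y; simp
  rw [h1] at h
  have := Finset.card_insert_le z ({x} : Finset W)
  simp at this
  omega

lemma codeg_le {W : Type} [Fintype W] (H : Finset (Finset W)) (p : Sym2 W) :
    codeg H p < Fintype.card W + 1 :=
  Nat.lt_succ_of_le (Finset.card_le_univ _)

/-- Weighted homomorphism count. -/
noncomputable def whom {V W : Type} [Fintype V] [Fintype W] (G : SimpleGraph V)
    (c : Sym2 W → ℕ) : ℕ :=
  ∑ f : V → W, ∏ e : G.edgeSet, c (Sym2.map f e)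

lemma count_expansion {V W : Type} [Fintype V] [Fintype W] (G : SimpleGraph V)
    (H : Finset (Finset W)) :
    (Finset.univ.filter (fun g : V ⊕ G.edgeSet → W =>
      ∀ e ∈ looseExpansion G, e.image g ∈ H)).card = whom G (codeg H) := by
  have key : ∀ f : V → W, ∏ e : G.edgeSet, codeg H (Sym2.map f e) =
      (Fintype.piFinset (fun e : G.edgeSet => Finset.univ.filter
        (fun z : W => insert z (Finset.univ.filter (· ∈ Sym2.map f e)) ∈ H))).card := by
    intro f
    rw [Fintype.card_piFinset]
    rfl
  unfold whom
  simp_rw [key]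
  rw [← Finset.card_sigma]
  refine Finset.card_bij' (fun g _ => ⟨fun v => g (Sum.inl v), fun e => g (Sum.inr e)⟩)
    (fun p _ => Sum.elim p.1 p.2) ?_ ?_ ?_ ?_
  · intro g hg
    simp only [Finset.mem_filter, Finset.mem_univ, true_and, looseExpansion,
      Finset.mem_image, forall_exists_index] at hg
    simp only [Finset.mem_sigma, Finset.mem_univ, true_and, Fintype.mem_piFinset,
      Finset.mem_filter]
    intro e
    have := hg _ e rfl
    rw [Finset.image_insert, Finset.image_image] at this
    have hE : Finset.univ.filter (· ∈ Sym2.map (fun v => g (Sum.inl v)) (e : Sym2 V)) =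
        (Finset.univ.filter (· ∈ (e : Sym2 V))).image (fun v => g (Sum.inl v)) := by
      ext y; simp [Sym2.mem_map]
    rw [hE]
    convert this using 2
    rfl
  · intro p hp
    simp only [Finset.mem_sigma, Finset.mem_univ, true_and, Fintype.mem_piFinset,
      Finset.mem_filter] at hp
    simp only [Finset.mem_filter, Finset.mem_univ, true_and, looseExpansion,
      Finset.mem_image, forall_exists_index]
    rintro _ e rfl
    have := hp e
    rw [Finset.image_insert, Finset.image_image]
    have hE : Finset.univ.filter (· ∈ Sym2.map p.1 (e : Sym2 V)) =
        (Finset.univ.filter (· ∈ (e : Sym2 V))).image p.1 := by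
      ext y; simp [Sym2.mem_map]
    rw [hE] at this
    convert this using 2
    · rfl
    · rfl
  · intro g _
    funext x
    cases x <;> rfl
  · intro p _
    rfl

lemma count_K3 {W : Type} [Fintype W] (H : Finset (Finset W)) :
    (Finset.univ.filter (fun g : Fin 3 → W => ∀ e ∈ K3edge, e.image g ∈ H)).card
      = ∑ p : W × W, codeg H s(p.1, p.2) := by
  unfold codeg
  rw [← Finset.card_sigma]
  have himg : ∀ x y z : W, insert z (Finset.univ.filter (· ∈ s(x, y))) = ({x, y, z} : Finset W) := by
    intro x y z; ext w; simp; tauto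
  have himg2 : ∀ g : Fin 3 → W, Finset.univ.image g = ({g 0, g 1, g 2} : Finset W) := by
    intro g; ext w; simp [Fin.exists_fin_succ, eq_comm]
  refine Finset.card_bij' (fun g _ => ⟨(g 0, g 1), g 2⟩)
    (fun p _ => ![p.1.1, p.1.2, p.2]) ?_ ?_ ?_ ?_
  · intro g hg
    simp only [Finset.mem_filter, Finset.mem_univ, true_and, K3edge, Finset.mem_singleton,
      forall_eq, himg2] at hg
    simp only [Finset.mem_sigma, Finset.mem_univ, true_and, Finset.mem_filter, himg]
    exact hg
  · intro p hp
    simp only [Finset.mem_sigma, Finset.mem_univ, true_and, Finset.mem_filter, himg] at hp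
    simp only [Finset.mem_filter, Finset.mem_univ, true_and, K3edge, Finset.mem_singleton,
      forall_eq, himg2]
    exact hp
  · intro g _
    funext i
    fin_cases i <;> rfl
  · intro p _
    rfl

/-- Level graph of the `k`-th tensor power of `c`. -/
def levelGraph {W : Type} (c : Sym2 W → ℕ) (hc : ∀ x, c s(x, x) = 0) (k s : ℕ) (hk : k ≠ 0) :
    SimpleGraph (Fin k → W) where
  Adj X Y := s ≠ 0 ∧ ∏ i, c s(X i, Y i) = s
  symm := ⟨by
    rintro X Y ⟨h0, h⟩
    refine ⟨h0, ?_⟩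
    rw [← h]
    exact Finset.prod_congr rfl fun i _ => by rw [Sym2.eq_swap]⟩
  loopless := ⟨by
    rintro X ⟨h0, h⟩
    apply h0
    rw [← h]
    exact Finset.prod_eq_zero (Finset.mem_univ ⟨0, Nat.pos_of_ne_zero hk⟩) (hc _)⟩

lemma whom_pow {V W : Type} [Fintype V] [Fintype W] (G : SimpleGraph V)
    (c : Sym2 W → ℕ) (k : ℕ) :
    whom G c ^ k = ∑ F : V → (Fin k → W), ∏ e : G.edgeSet, ∏ i,
      c (Sym2.map (fun v => F v i) e) := by
  unfold whom
  rw [Fintype.sum_pow]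
  refine Fintype.sum_equiv (Equiv.piComm (fun (_ : Fin k) (_ : V) => W)) _ _ ?_
  intro p
  rw [Finset.prod_comm]
  rfl

lemma level_le {V W : Type} [Fintype V] [Fintype W] (G : SimpleGraph V)
    (c : Sym2 W → ℕ) (hc : ∀ x, c s(x, x) = 0) (k s : ℕ) (hk : k ≠ 0) :
    s ^ G.edgeFinset.card * (Finset.univ.filter (fun f : V → (Fin k → W) =>
      ∀ ⦃u v : V⦄, G.Adj u v → (levelGraph c hc k s hk).Adj (f u) (f v))).card
      ≤ whom G c ^ k := by
  rw [whom_pow, mul_comm, ← smul_eq_mul]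
  refine le_trans (Finset.card_nsmul_le_sum _ (fun F : V → (Fin k → W) =>
    ∏ e : G.edgeSet, ∏ i, c (Sym2.map (fun v => F v i) e)) _ ?_)
    (Finset.sum_le_sum_of_subset (Finset.filter_subset _ _))
  intro F hF
  simp only [Finset.mem_filter, Finset.mem_univ, true_and] at hF
  have : ∀ e : G.edgeSet, ∏ i, c (Sym2.map (fun v => F v i) e) = s := by
    rintro ⟨e, he⟩
    induction e using Sym2.ind with
    | _ u v => exact (hF he).2
  simp_rw [this]
  rw [Finset.prod_const, SimpleGraph.edgeFinset_card, Finset.card_univ]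

lemma count_edge {W : Type} [Fintype W] (H : SimpleGraph W) :
    (Finset.univ.filter (fun f : Fin 2 → W =>
      ∀ ⦃u v : Fin 2⦄, (⊤ : SimpleGraph (Fin 2)).Adj u v → H.Adj (f u) (f v))).card
    = (Finset.univ.filter (fun p : W × W => H.Adj p.1 p.2)).card := by
  refine Finset.card_equiv (finTwoArrowEquiv W) ?_
  intro f
  simp only [Finset.mem_filter, Finset.mem_univ, true_and, finTwoArrowEquiv_apply]
  constructor
  · intro h
    exact h (by simp)
  · intro h u v huv
    fin_cases u <;> fin_cases v
    · simp at huv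
    · exact h
    · exact h.symm
    · simp at huv

lemma homDensity_edge {W : Type} [Fintype W] (H : SimpleGraph W) :
    homDensity (⊤ : SimpleGraph (Fin 2)) H =
      ((Finset.univ.filter (fun p : W × W => H.Adj p.1 p.2)).card : ℝ) /
        (Fintype.card W : ℝ) ^ 2 := by
  rw [← count_edge]
  unfold homDensity
  rw [Fintype.card_fin]
  congr!

lemma sum_levels {W : Type} [Fintype W] (c : Sym2 W → ℕ) (hc : ∀ x, c s(x, x) = 0)
    (n : ℕ) (hn : ∀ p, c p < n) (k : ℕ) (hk : k ≠ 0) :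
    ∃ S : Finset ℕ, S.Nonempty ∧ S.card ≤ (k + 1) ^ n ∧
      (∑ p : W × W, c s(p.1, p.2)) ^ k = ∑ s ∈ S, s * (Finset.univ.filter
        (fun p : (Fin k → W) × (Fin k → W) => (levelGraph c hc k s hk).Adj p.1 p.2)).card := by
  refine ⟨Finset.univ.image (fun q : Fin n → Fin (k + 1) => ∏ j : Fin n, (j : ℕ) ^ (q j : ℕ)),
    ⟨_, Finset.mem_image_of_mem _ (Finset.mem_univ (fun _ => 0))⟩, ?_, ?_⟩
  · refine Finset.card_image_le.trans ?_
    simp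
  · rw [Fintype.sum_pow]
    have h1 : ∑ p : Fin k → W × W, ∏ i, c s((p i).1, (p i).2) =
        ∑ p : (Fin k → W) × (Fin k → W), ∏ i, c s(p.1 i, p.2 i) :=
      Fintype.sum_equiv (Equiv.arrowProdEquivProdArrow (Fin k) (fun _ => W) (fun _ => W)) _ _
        (fun p => rfl)
    rw [h1]
    rw [← Finset.sum_fiberwise_of_maps_to
      (g := fun p : (Fin k → W) × (Fin k → W) => ∏ i, c s(p.1 i, p.2 i))
      (t := Finset.univ.image (fun q : Fin n → Fin (k + 1) => ∏ j : Fin n, (j : ℕ) ^ (q j : ℕ)))]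
    · refine Finset.sum_congr rfl fun s _ => ?_
      rw [Finset.sum_congr rfl (fun p hp => (Finset.mem_filter.1 hp).2), Finset.sum_const,
        smul_eq_mul, mul_comm]
      by_cases hs : s = 0
      · simp [hs]
      · congr 2
        ext p
        simp [levelGraph, hs]
    · intro p _
      rw [Finset.mem_image]
      refine ⟨fun j => ⟨(Finset.univ.filter (fun i : Fin k => c s(p.1 i, p.2 i) = j)).card,
        Nat.lt_succ_of_le ((Finset.card_le_univ _).trans (by simp))⟩, Finset.mem_univ _, ?_⟩
      rw [← Finset.prod_fiberwise_of_maps_to (s := Finset.univ) (t := Finset.univ)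
        (g := fun i : Fin k => (⟨c s(p.1 i, p.2 i), hn _⟩ : Fin n))
        (fun _ _ => Finset.mem_univ _)]
      refine Finset.prod_congr rfl fun j _ => ?_
      have : ∀ i ∈ Finset.univ.filter
          (fun i : Fin k => (⟨c s(p.1 i, p.2 i), hn _⟩ : Fin n) = j),
          c s(p.1 i, p.2 i) = j := by
        intro i hi
        exact congrArg Fin.val (Finset.mem_filter.1 hi).2
      rw [Finset.prod_congr rfl this, Finset.prod_const]
      simp only [Fin.ext_iff]

lemma le_of_pow_le_poly (A T : ℝ) (hT : 0 ≤ T) (M : ℕ)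
    (h : ∀ k : ℕ, k ≠ 0 → A ^ k ≤ ((k : ℝ) + 1) ^ M * T ^ k) : A ≤ T := by
  by_contra! hlt
  rcases hT.eq_or_lt with rfl | hT
  · have := h 1 one_ne_zero
    simp at this
    linarith
  · have hr : 1 < A / T := (one_lt_div hT).2 hlt
    have ht := tendsto_pow_const_div_const_pow_of_one_lt M hr
    have hp : (0 : ℝ) < 1 / 2 ^ M := by positivity
    obtain ⟨k, hk1, hk2⟩ := ((ht.eventually (gt_mem_nhds hp)).and
      (Filter.eventually_ge_atTop 1)).exists
    have h1 := h k (by omega)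
    have hk : (1 : ℝ) ≤ k := by exact_mod_cast hk2
    have h2 : ((k : ℝ) + 1) ^ M ≤ 2 ^ M * (k : ℝ) ^ M := by
      rw [← mul_pow]
      exact pow_le_pow_left₀ (by positivity) (by linarith) _
    have hpos : 0 < (A / T) ^ k := by positivity
    rw [div_lt_div_iff₀ hpos (by positivity), div_pow, one_mul, lt_div_iff₀ (by positivity)] at hk1
    have h3 : ((k : ℝ) + 1) ^ M * T ^ k ≤ 2 ^ M * (k : ℝ) ^ M * T ^ k :=
      mul_le_mul_of_nonneg_right h2 (by positivity)
    nlinarith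

lemma weighted_sidorenko {V : Type} [Fintype V] (G : SimpleGraph V)
    (hG : ∀ (W : Type) [Fintype W] (H : SimpleGraph W),
      homDensity G H ≥ homDensity (⊤ : SimpleGraph (Fin 2)) H ^ G.edgeFinset.card)
    {W : Type} [Fintype W] (c : Sym2 W → ℕ) (hc : ∀ x, c s(x, x) = 0)
    (n : ℕ) (hn : ∀ p, c p < n) :
    (((∑ p : W × W, c s(p.1, p.2) : ℕ) : ℝ) / (Fintype.card W : ℝ) ^ 2) ^ G.edgeFinset.card
      ≤ (whom G c : ℝ) / (Fintype.card W : ℝ) ^ Fintype.card V := by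
  refine le_of_pow_le_poly _ _ (by positivity) (n * G.edgeFinset.card) ?_
  intro k hk
  obtain ⟨S, hS, hcard, hsum⟩ := sum_levels c hc n hn k hk
  set a : ℕ := ∑ p : W × W, c s(p.1, p.2)
  set m : ℕ := G.edgeFinset.card
  set E : ℕ → ℕ := fun s => (Finset.univ.filter
        (fun p : (Fin k → W) × (Fin k → W) => (levelGraph c hc k s hk).Adj p.1 p.2)).card
  obtain ⟨s, hs, hmax⟩ := Finset.exists_max_image S (fun s => s * E s) hS
  have h1 : a ^ k ≤ (k + 1) ^ n * (s * E s) := by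
    rw [hsum]
    refine (Finset.sum_le_card_nsmul S _ _ hmax).trans ?_
    rw [smul_eq_mul]
    exact Nat.mul_le_mul_right _ hcard
  have h1' : (a : ℝ) ^ k ≤ ((k : ℝ) + 1) ^ n * (s * E s) := by exact_mod_cast h1
  have h2 := hG _ (levelGraph c hc k s hk)
  rw [homDensity_edge] at h2
  unfold homDensity at h2
  have h3 : ((s ^ m * _ : ℕ) : ℝ) ≤ ((whom G c ^ k : ℕ) : ℝ) :=
    Nat.cast_le.2 (level_le G c hc k s hk)
  set N : ℕ := (Finset.univ.filter (fun f : V → (Fin k → W) =>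
      ∀ ⦃u v : V⦄, G.Adj u v → (levelGraph c hc k s hk).Adj (f u) (f v))).card
  simp only [Fintype.card_pi, Finset.prod_const, Finset.card_univ, Fintype.card_fin,
    Nat.cast_pow] at h2
  push_cast at h3
  set w : ℝ := (Fintype.card W : ℝ)
  have hw : 0 ≤ w := Nat.cast_nonneg _
  have h4 : ((E s : ℝ) / (w ^ k) ^ 2) ^ m ≤ (N : ℝ) / (w ^ k) ^ Fintype.card V := h2
  calc (((a : ℝ) / w ^ 2) ^ m) ^ k = ((a : ℝ) ^ k / (w ^ k) ^ 2) ^ m := by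
        rw [← pow_mul, mul_comm m k, pow_mul, div_pow, ← pow_mul, ← pow_mul, mul_comm 2 k]
    _ ≤ (((k : ℝ) + 1) ^ n * (s * E s) / (w ^ k) ^ 2) ^ m := by gcongr
    _ = ((k : ℝ) + 1) ^ (n * m) * ((s : ℝ) ^ m * ((E s : ℝ) / (w ^ k) ^ 2) ^ m) := by
        rw [pow_mul, ← mul_pow, ← mul_pow]; congr 1; ring
    _ ≤ ((k : ℝ) + 1) ^ (n * m) * ((s : ℝ) ^ m * ((N : ℝ) / (w ^ k) ^ Fintype.card V)) := by
        gcongr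
    _ = ((k : ℝ) + 1) ^ (n * m) * (((s : ℝ) ^ m * (N : ℝ)) / (w ^ k) ^ Fintype.card V) := by
        ring
    _ ≤ ((k : ℝ) + 1) ^ (n * m) * (((whom G c : ℝ) ^ k) / (w ^ k) ^ Fintype.card V) := by
        gcongr
    _ = ((k : ℝ) + 1) ^ (n * m) * ((whom G c : ℝ) / w ^ Fintype.card V) ^ k := by
        rw [div_pow, ← pow_mul, ← pow_mul, mul_comm k]

/-- If `G` is a Sidorenko graph, then its 3-uniform loose expansion is Sidorenko:
`t(G⁺, H) ≥ t(K₃⁽³⁾, H)^{e(G)}` for every 3-uniform hypergraph `H`. -/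
theorem looseExpansion_sidorenko {V : Type} [Fintype V] (G : SimpleGraph V)
    (hG : ∀ (W : Type) [Fintype W] (H : SimpleGraph W),
      homDensity G H ≥ homDensity (⊤ : SimpleGraph (Fin 2)) H ^ G.edgeFinset.card) :
    ∀ (W : Type) [Fintype W] (H : Finset (Finset W)), (∀ e ∈ H, e.card = 3) →
      hHomDensity (looseExpansion G) H ≥ hHomDensity K3edge H ^ G.edgeFinset.card := by
  intro W _ H hH
  have h := weighted_sidorenko G hG (codeg H) (codeg_diag H hH) _ (codeg_le H)
  have e1 : hHomDensity (looseExpansion G) H = (whom G (codeg H) : ℝ) /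
      (Fintype.card W : ℝ) ^ (Fintype.card V + G.edgeFinset.card) := by
    rw [← count_expansion, SimpleGraph.edgeFinset_card, ← Fintype.card_sum]
    unfold hHomDensity
    congr!
  have e2 : hHomDensity K3edge H = ((∑ p : W × W, codeg H s(p.1, p.2) : ℕ) : ℝ) /
      (Fintype.card W : ℝ) ^ 3 := by
    rw [← count_K3]
    unfold hHomDensity
    rw [Fintype.card_fin]
    congr!
  rw [e1, e2, ge_iff_le, pow_add, ← div_div, pow_succ _ 2, ← div_div,
    div_pow _ (Fintype.card W : ℝ)]
  exact div_le_div_of_nonneg_right h (by positivity)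
end

section
/- A bound towards Sidorenko for the Möbius ladder M₅: if for all graphs H the labeled C₅-density satisfies t(C₅,H) ≥ 4p⁴ − 6p³ + 4p² − p with p = t(K₂,H), then t(M₅, H) ≥ 4p¹³ − 6p¹¹ + 4p⁹ − p⁷; in particular this exceeds p¹⁷ whenever p ≥ 0.74142. -/
open Finset
open scoped Classical

/-- The Möbius ladder `M₅`: the cycle `C₁₀` together with the five chords joining opposite
vertices; equivalently, `K_{5,5}` minus a Hamilton cycle `C₁₀`. -/
def mobiusLadder5 : SimpleGraph (Fin 10) :=
  SimpleGraph.fromRel (fun i j => j = i + 1 ∨ j = i + 5)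

lemma k2_density {W : Type} [Fintype W] (H : SimpleGraph W) :
    homDensity (⊤ : SimpleGraph (Fin 2)) H =
      ((Finset.univ.filter (fun x : W × W => H.Adj x.1 x.2)).card : ℝ) /
        (Fintype.card W : ℝ) ^ 2 := by
  unfold homDensity
  rw [Fintype.card_fin]
  congr 2
  refine Finset.card_equiv (finTwoArrowEquiv W) ?_
  intro f
  simp only [Finset.mem_filter, Finset.mem_univ, true_and, finTwoArrowEquiv_apply]
  constructor
  · intro h
    exact h (by simp)
  · intro h u v huv
    fin_cases u <;> fin_cases v <;> simp_all [H.adj_comm]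

/-- The auxiliary graph: vertices are ordered edges of `H` with a label. -/
def auxGraph {W : Type} (H : SimpleGraph W) (m : ℕ) :
    SimpleGraph ({e : W × W // H.Adj e.1 e.2} × Fin m) where
  Adj x y := H.Adj x.1.1.1 y.1.1.2 ∧ H.Adj x.1.1.2 y.1.1.1 ∧ x.2 ≠ y.2
  symm := ⟨fun _ _ h => ⟨h.2.1.symm, h.1.symm, h.2.2.symm⟩⟩
  loopless := ⟨fun _ h => h.2.2 rfl⟩

/-- labelled four-cycles -/
noncomputable def c4Set {W : Type} [Fintype W] (H : SimpleGraph W) :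
    Finset ((W × W) × (W × W)) :=
  Finset.univ.filter (fun q => H.Adj q.1.1 q.1.2 ∧ H.Adj q.2.1 q.2.2 ∧
    H.Adj q.1.1 q.2.2 ∧ H.Adj q.1.2 q.2.1)

lemma c4_bound {W : Type} [Fintype W] (H : SimpleGraph W) :
    ((Finset.univ.filter (fun x : W × W => H.Adj x.1 x.2)).card : ℝ) ^ 4 ≤
      ((c4Set H).card : ℝ) * (Fintype.card W : ℝ) ^ 4 := by
  set A : W → W → ℝ := fun u v => if H.Adj u v then 1 else 0 with hA
  set n : ℝ := (Fintype.card W : ℝ) with hn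
  have hsym : ∀ u v, A u v = A v u := fun u v => by simp [hA, H.adj_comm]
  have h1 : ((Finset.univ.filter (fun x : W × W => H.Adj x.1 x.2)).card : ℝ)
      = ∑ v, ∑ u, A v u := by
    rw [Finset.card_filter, Fintype.sum_prod_type]
    push_cast
    rfl
  have h2 : ((c4Set H).card : ℝ) = ∑ u, ∑ x, (∑ v, A u v * A v x) ^ 2 := by
    unfold c4Set
    rw [Finset.card_filter]
    simp only [Fintype.sum_prod_type]
    push_cast
    refine Finset.sum_congr rfl fun u _ => ?_
    rw [Finset.sum_comm]
    refine Finset.sum_congr rfl fun x _ => ?_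
    rw [sq, Finset.sum_mul_sum]
    refine Finset.sum_congr rfl fun v _ => Finset.sum_congr rfl fun y _ => ?_
    simp only [hA]
    by_cases a : H.Adj u v <;> by_cases b : H.Adj x y <;> by_cases c : H.Adj u y <;>
      by_cases d : H.Adj v x <;> simp [a, b, c, d, H.adj_comm y x]
  have h3 : (∑ v, ∑ u, A v u) ^ 2 ≤ n * ∑ v, (∑ u, A v u) ^ 2 := by
    have := sq_sum_le_card_mul_sum_sq (s := (Finset.univ : Finset W)) (f := fun v => ∑ u, A v u)
    simpa using this
  have h4 : ∑ v, (∑ u, A v u) ^ 2 = ∑ q : W × W, ∑ v, A q.1 v * A v q.2 := by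
    rw [Fintype.sum_prod_type]
    simp_rw [sq, Finset.sum_mul_sum]
    rw [Finset.sum_comm]
    refine Finset.sum_congr rfl fun u _ => ?_
    rw [Finset.sum_comm]
    refine Finset.sum_congr rfl fun x _ => Finset.sum_congr rfl fun v _ => ?_
    rw [hsym v u]
  have h5 : (∑ q : W × W, ∑ v, A q.1 v * A v q.2) ^ 2 ≤
      n ^ 2 * ∑ u, ∑ x, (∑ v, A u v * A v x) ^ 2 := by
    have := sq_sum_le_card_mul_sum_sq (s := (Finset.univ : Finset (W × W)))
      (f := fun q => ∑ v, A q.1 v * A v q.2)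
    rw [Fintype.sum_prod_type (f := fun q : W × W => (∑ v, A q.1 v * A v q.2) ^ 2)] at this
    simpa [sq, Fintype.card_prod] using this
  rw [h1, h2]
  rw [h4] at h3
  have hn0 : 0 ≤ n := by positivity
  calc (∑ v, ∑ u, A v u) ^ 4 = ((∑ v, ∑ u, A v u) ^ 2) ^ 2 := by ring
    _ ≤ (n * ∑ q : W × W, ∑ v, A q.1 v * A v q.2) ^ 2 :=
        pow_le_pow_left₀ (by positivity) h3 2
    _ = n ^ 2 * (∑ q : W × W, ∑ v, A q.1 v * A v q.2) ^ 2 := by ring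
    _ ≤ n ^ 2 * (n ^ 2 * ∑ u, ∑ x, (∑ v, A u v * A v x) ^ 2) := by gcongr
    _ = _ := by ring

lemma aux_k2 {W : Type} [Fintype W] (H : SimpleGraph W) (m : ℕ) :
    (c4Set H).card * (m * m - m) ≤
      (Finset.univ.filter (fun x : ({e : W × W // H.Adj e.1 e.2} × Fin m) ×
        ({e : W × W // H.Adj e.1 e.2} × Fin m) => (auxGraph H m).Adj x.1 x.2)).card := by
  have h : (Finset.univ.offDiag : Finset (Fin m × Fin m)).card = m * m - m := by
    simp [Finset.offDiag_card]
  rw [← h, ← Finset.card_product]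
  refine Finset.card_le_card_of_surjOn
    (fun x => ((x.1.1.1, x.2.1.1), (x.1.2, x.2.2))) ?_
  rintro ⟨⟨e, f⟩, a, b⟩ hq
  simp only [c4Set, Finset.coe_product, Set.mem_prod, Finset.mem_coe, Finset.mem_filter,
    Finset.mem_univ, true_and, Finset.mem_offDiag] at hq
  obtain ⟨⟨h1, h2, h3, h4⟩, hab⟩ := hq
  refine ⟨((⟨e, h1⟩, a), (⟨f, h2⟩, b)), ?_, rfl⟩
  simp only [Finset.coe_filter, Finset.mem_univ, true_and, Set.mem_ofPred_eq]
  exact ⟨h3, h4, hab⟩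

lemma aux_c5 {W : Type} [Fintype W] (H : SimpleGraph W) (m : ℕ) :
    (Finset.univ.filter (fun f : Fin 5 → {e : W × W // H.Adj e.1 e.2} × Fin m =>
      ∀ ⦃u v : Fin 5⦄, (SimpleGraph.cycleGraph 5).Adj u v →
        (auxGraph H m).Adj (f u) (f v))).card ≤
    (Finset.univ.filter (fun f : Fin 10 → W =>
      ∀ ⦃u v : Fin 10⦄, mobiusLadder5.Adj u v → H.Adj (f u) (f v))).card * m ^ 5 := by
  have h : (Finset.univ : Finset (Fin 5 → Fin m)).card = m ^ 5 := by simp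
  rw [← h, ← Finset.card_product]
  refine Finset.card_le_card_of_injOn
    (fun f => (![(f 0).1.1.1, (f 1).1.1.2, (f 2).1.1.1, (f 3).1.1.2, (f 4).1.1.1,
      (f 0).1.1.2, (f 1).1.1.1, (f 2).1.1.2, (f 3).1.1.1, (f 4).1.1.2],
      fun i => (f i).2)) ?_ ?_
  · intro f hf
    simp only [Finset.coe_filter, Finset.mem_univ, true_and, Set.mem_ofPred_eq] at hf
    simp only [Finset.coe_product, Set.mem_prod, Finset.mem_coe, Finset.mem_filter,
      Finset.mem_univ, true_and, and_true]
    have a0 := hf (u := 0) (v := 1) (by decide)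
    have a1 := hf (u := 1) (v := 2) (by decide)
    have a2 := hf (u := 2) (v := 3) (by decide)
    have a3 := hf (u := 3) (v := 4) (by decide)
    have a4 := hf (u := 4) (v := 0) (by decide)
    have b0 := (f 0).1.2
    have b1 := (f 1).1.2
    have b2 := (f 2).1.2
    have b3 := (f 3).1.2
    have b4 := (f 4).1.2
    have key : ∀ g : Fin 10 → W, (∀ i, H.Adj (g i) (g (i + 1)) ∧ H.Adj (g i) (g (i + 5))) →
        ∀ ⦃u v : Fin 10⦄, mobiusLadder5.Adj u v → H.Adj (g u) (g v) := by
      intro g hg u v huv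
      rw [mobiusLadder5, SimpleGraph.fromRel_adj] at huv
      obtain ⟨-, (rfl | rfl) | (rfl | rfl)⟩ := huv
      · exact (hg _).1
      · exact (hg _).2
      · exact (hg _).1.symm
      · exact (hg _).2.symm
    apply key
    intro i
    fin_cases i
    · exact ⟨a0.1, b0⟩
    · exact ⟨a1.2.1, b1.symm⟩
    · exact ⟨a2.1, b2⟩
    · exact ⟨a3.2.1, b3.symm⟩
    · exact ⟨a4.1, b4⟩
    · exact ⟨a0.2.1, b0.symm⟩
    · exact ⟨a1.1, b1⟩
    · exact ⟨a2.2.1, b2.symm⟩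
    · exact ⟨a3.1, b3⟩
    · exact ⟨a4.2.1, b4.symm⟩
  · intro f _ g _ hfg
    simp only [Prod.mk.injEq] at hfg
    obtain ⟨h1, h2⟩ := hfg
    have e := fun i => congrFun h1 i
    funext i
    refine Prod.ext (Subtype.ext (Prod.ext ?_ ?_)) (congrFun h2 i)
    · fin_cases i
      · exact e 0
      · exact e 6
      · exact e 2
      · exact e 8
      · exact e 4
    · fin_cases i
      · exact e 5
      · exact e 1
      · exact e 7
      · exact e 3
      · exact e 9

lemma density_eq {W : Type} [Fintype W] {k : ℕ} (G : SimpleGraph (Fin k)) (H : SimpleGraph W)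
    (S : Finset (Fin k → W))
    (hS : ∀ f, f ∈ S ↔ ∀ ⦃u v : Fin k⦄, G.Adj u v → H.Adj (f u) (f v)) :
    homDensity G H = (S.card : ℝ) / (Fintype.card W : ℝ) ^ k := by
  unfold homDensity
  rw [Fintype.card_fin]
  congr 3
  ext f
  rw [hS]
  simp

lemma aux_c5' {W : Type} [Fintype W] (H : SimpleGraph W) (m : ℕ) :
    ∃ a b : ℝ, homDensity (SimpleGraph.cycleGraph 5) (auxGraph H m) =
        a / ((Fintype.card {e : W × W // H.Adj e.1 e.2} : ℝ) * (m : ℝ)) ^ 5 ∧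
      homDensity mobiusLadder5 H = b / (Fintype.card W : ℝ) ^ 10 ∧
      a ≤ b * (m : ℝ) ^ 5 := by
  have h := (Nat.cast_le (α := ℝ)).2 (aux_c5 H m)
  rw [Nat.cast_mul, Nat.cast_pow] at h
  refine ⟨_, _, ?_, ?_, h⟩
  · refine (density_eq (SimpleGraph.cycleGraph 5) (auxGraph H m)
      (Finset.univ.filter (fun f : Fin 5 → {e : W × W // H.Adj e.1 e.2} × Fin m =>
        ∀ ⦃u v : Fin 5⦄, (SimpleGraph.cycleGraph 5).Adj u v →
          (auxGraph H m).Adj (f u) (f v)))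
      (fun f => by rw [Finset.mem_filter]; exact and_iff_right (Finset.mem_univ f))).trans ?_
    rw [Fintype.card_prod, Fintype.card_fin, Nat.cast_mul]
  · exact density_eq mobiusLadder5 H _
      (fun f => by rw [Finset.mem_filter]; exact and_iff_right (Finset.mem_univ f))

lemma poly_mono (t s q : ℝ) (ht : 0 ≤ t) (hq : 0 ≤ q) (hqs : q ≤ s)
    (h : 4 * s ^ 4 - 6 * s ^ 3 + 4 * s ^ 2 - s ≤ t) :
    4 * q ^ 4 - 6 * q ^ 3 + 4 * q ^ 2 - q ≤ t := by
  have e : ∀ x : ℝ, 4 * x ^ 4 - 6 * x ^ 3 + 4 * x ^ 2 - x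
      = x * (4 * x ^ 3 - 6 * x ^ 2 + 4 * x - 1) := fun x => by ring
  rw [e] at h ⊢
  have hm : 4 * q ^ 3 - 6 * q ^ 2 + 4 * q - 1 ≤ 4 * s ^ 3 - 6 * s ^ 2 + 4 * s - 1 := by
    have : 0 ≤ (s - q) * (4 * (s ^ 2 + s * q + q ^ 2) - 6 * (s + q) + 4) := by
      apply mul_nonneg (by linarith)
      nlinarith [sq_nonneg (s - q), sq_nonneg (s + q - 1)]
    nlinarith
  rcases le_total (4 * q ^ 3 - 6 * q ^ 2 + 4 * q - 1) 0 with h0 | h0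
  · exact (mul_nonpos_of_nonneg_of_nonpos hq h0).trans ht
  · exact (mul_le_mul hqs hm h0 (hq.trans hqs)).trans h

lemma numeric (p : ℝ) (h1 : 0.74142 ≤ p) (h2 : p ≤ 1) :
    4 * p ^ 13 - 6 * p ^ 11 + 4 * p ^ 9 - p ^ 7 ≥ p ^ 17 := by
  have e : 4 * p ^ 13 - 6 * p ^ 11 + 4 * p ^ 9 - p ^ 7 - p ^ 17
      = p ^ 7 * ((1 - p ^ 2) * ((p ^ 2) ^ 4 - (1 - p ^ 2) ^ 3)) := by ring
  have hx : (0.74142 : ℝ) ^ 2 ≤ p ^ 2 := pow_le_pow_left₀ (by norm_num) h1 2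
  have hx1 : p ^ 2 ≤ 1 := pow_le_one₀ (by linarith) h2
  have a : ((0.74142 : ℝ) ^ 2) ^ 4 ≤ (p ^ 2) ^ 4 := pow_le_pow_left₀ (by norm_num) hx 4
  have b : (1 - p ^ 2) ^ 3 ≤ (1 - (0.74142 : ℝ) ^ 2) ^ 3 :=
    pow_le_pow_left₀ (by linarith) (by linarith) 3
  have c : (1 - (0.74142 : ℝ) ^ 2) ^ 3 ≤ ((0.74142 : ℝ) ^ 2) ^ 4 := by norm_num
  have : 0 ≤ p ^ 7 * ((1 - p ^ 2) * ((p ^ 2) ^ 4 - (1 - p ^ 2) ^ 3)) :=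
    mul_nonneg (pow_nonneg (by linarith) _) (mul_nonneg (by linarith) (by linarith))
  linarith

theorem mobius_ladder_bound
    (hC5 : ∀ (W : Type) [Fintype W] (H : SimpleGraph W),
      homDensity (SimpleGraph.cycleGraph 5) H ≥
        4 * homDensity (⊤ : SimpleGraph (Fin 2)) H ^ 4
          - 6 * homDensity (⊤ : SimpleGraph (Fin 2)) H ^ 3
          + 4 * homDensity (⊤ : SimpleGraph (Fin 2)) H ^ 2
          - homDensity (⊤ : SimpleGraph (Fin 2)) H) :
    (∀ (W : Type) [Fintype W] (H : SimpleGraph W),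
      homDensity mobiusLadder5 H ≥
        4 * homDensity (⊤ : SimpleGraph (Fin 2)) H ^ 13
          - 6 * homDensity (⊤ : SimpleGraph (Fin 2)) H ^ 11
          + 4 * homDensity (⊤ : SimpleGraph (Fin 2)) H ^ 9
          - homDensity (⊤ : SimpleGraph (Fin 2)) H ^ 7)
    ∧ (∀ p : ℝ, 0.74142 ≤ p → p ≤ 1 →
        4 * p ^ 13 - 6 * p ^ 11 + 4 * p ^ 9 - p ^ 7 ≥ p ^ 17) := by
  refine ⟨?_, numeric⟩
  intro W _ H
  set p := homDensity (⊤ : SimpleGraph (Fin 2)) H with hp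
  have hM0 : 0 ≤ homDensity mobiusLadder5 H := by unfold homDensity; positivity
  have hpe := k2_density H
  rw [← hp] at hpe
  have hp0 : 0 ≤ p := by rw [hpe]; positivity
  rcases hp0.eq_or_lt with hz | hpos
  · rw [← hz]; simpa using hM0
  set e : ℝ := ((Finset.univ.filter (fun x : W × W => H.Adj x.1 x.2)).card : ℝ) with he
  set n : ℝ := (Fintype.card W : ℝ) with hn
  have hn0 : 0 < n := by
    rcases (show 0 ≤ n by positivity).eq_or_lt with h | h
    · rw [hpe, ← h] at hpos; simp at hpos
    · exact h
  have hep : e = p * n ^ 2 := by rw [hpe]; field_simp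
  have he0 : 0 < e := by rw [hep]; positivity
  have hcard : (Fintype.card {x : W × W // H.Adj x.1 x.2} : ℝ) = e := by
    rw [he, Fintype.card_subtype]
  set M : ℝ := homDensity mobiusLadder5 H with hMdef
  have hc4 := c4_bound H
  rw [← he, ← hn] at hc4
  clear_value p e n M
  have main : ∀ k : ℕ, 4 * (p ^ 2 * (1 - 1 / ((k : ℝ) + 1))) ^ 4
      - 6 * (p ^ 2 * (1 - 1 / ((k : ℝ) + 1))) ^ 3
      + 4 * (p ^ 2 * (1 - 1 / ((k : ℝ) + 1))) ^ 2
      - (p ^ 2 * (1 - 1 / ((k : ℝ) + 1))) ≤ M / p ^ 5 := by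
    intro k
    have hm0 : (0 : ℝ) < (k : ℝ) + 1 := by positivity
    have hk := hC5 _ (auxGraph H (k + 1))
    have hk2 := k2_density (auxGraph H (k + 1))
    refine poly_mono _ (homDensity (⊤ : SimpleGraph (Fin 2)) (auxGraph H (k + 1))) _
      (by positivity) ?_ ?_ (le_trans hk ?_)
    · have : 1 / ((k : ℝ) + 1) ≤ 1 := by
        rw [div_le_one hm0]; linarith [(Nat.cast_nonneg k : (0 : ℝ) ≤ k)]
      exact mul_nonneg (by positivity) (by linarith)
    · rw [hk2, Fintype.card_prod, Fintype.card_fin]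
      push_cast
      rw [hcard]
      have h := aux_k2 H (k + 1)
      have h' := (Nat.cast_le (α := ℝ)).2 h
      have h3 : (k + 1) * (k + 1) - (k + 1) = (k + 1) * k := by
        rw [Nat.mul_succ, Nat.add_sub_cancel]
      rw [h3] at h'
      push_cast at h'
      rw [le_div_iff₀ (by positivity)]
      refine le_trans ?_ h'
      have h5 : p ^ 4 * n ^ 4 ≤ ((c4Set H).card : ℝ) := by
        have : p ^ 4 * n ^ 4 * n ^ 4 ≤ ((c4Set H).card : ℝ) * n ^ 4 := by
          refine le_trans (le_of_eq ?_) hc4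
          rw [hep]; ring
        exact le_of_mul_le_mul_right this (by positivity)
      calc p ^ 2 * (1 - 1 / ((k : ℝ) + 1)) * (e * ((k : ℝ) + 1)) ^ 2
          = p ^ 4 * n ^ 4 * (((k : ℝ) + 1) * k) := by rw [hep]; field_simp; ring
        _ ≤ _ := by gcongr
    · obtain ⟨a, b, ha, hb, hab⟩ := aux_c5' H (k + 1)
      rw [← hMdef, ← hn] at hb
      rw [hcard] at ha
      push_cast at ha hab
      rw [ha, div_le_iff₀ (by positivity)]
      refine le_trans hab (le_of_eq ?_)
      rw [hb, hep]
      field_simp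
  have lim : Filter.Tendsto (fun k : ℕ => 4 * (p ^ 2 * (1 - 1 / ((k : ℝ) + 1))) ^ 4
      - 6 * (p ^ 2 * (1 - 1 / ((k : ℝ) + 1))) ^ 3
      + 4 * (p ^ 2 * (1 - 1 / ((k : ℝ) + 1))) ^ 2
      - (p ^ 2 * (1 - 1 / ((k : ℝ) + 1)))) Filter.atTop
      (nhds (4 * (p ^ 2 * (1 - 0)) ^ 4 - 6 * (p ^ 2 * (1 - 0)) ^ 3
        + 4 * (p ^ 2 * (1 - 0)) ^ 2 - (p ^ 2 * (1 - 0)))) := by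
    have hc : Continuous (fun y : ℝ => 4 * (p ^ 2 * (1 - y)) ^ 4 - 6 * (p ^ 2 * (1 - y)) ^ 3
        + 4 * (p ^ 2 * (1 - y)) ^ 2 - (p ^ 2 * (1 - y))) := by fun_prop
    exact (hc.tendsto 0).comp tendsto_one_div_add_atTop_nhds_zero_nat
  have fin := le_of_tendsto' lim main
  rw [le_div_iff₀ (by positivity)] at fin
  refine le_trans (le_of_eq ?_) fin
  ring
end
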